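/- The map Φ: H²(g/g')_{1,3} ⊕ Lin(A, H²(k)) → H²(g) — which sends (h, ψ) to the class of the pull-back of h along the quotient g → g/g' plus the class of the cocycle f₂∘p₂ where f̃₂: A → Z²(k) is any linear lift of ψ — is well defined and injective, and its image consists precisely of the cohomology classes of 2-cocycles of the form f₁⁰∘p₁ + f₂∘p₂ + f₃∘p₃ in which f₁⁰∘p₁ vanishes on g × g'. -/

import Mathlib

set_option linter.unusedSectionVars false
set_option synthInstance.maxHeartbeats 1000000
set_option maxHeartbeats 1000000
open scoped TensorProduct

namespace CurrentPaper

variable (K : Type*) [Field K] [CharZero K]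

section Wedge

variable (V : Type*) [AddCommGroup V] [Module K V]

/-- `x ∧ y = (1/2)(x ⊗ y - y ⊗ x)` inside `V ⊗ V`. -/
noncomputable def wedge (x y : V) : V ⊗[K] V := (2 : K)⁻¹ • (x ⊗ₜ[K] y - y ⊗ₜ[K] x)

/-- `x ∨ y = (1/2)(x ⊗ y + y ⊗ x)` inside `V ⊗ V`. -/
noncomputable def vee (x y : V) : V ⊗[K] V := (2 : K)⁻¹ • (x ⊗ₜ[K] y + y ⊗ₜ[K] x)

/-- `Λ²(V)` realized as the subspace of skew-symmetric tensors of `V ⊗ V`. -/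
def lambda2 : Submodule K (V ⊗[K] V) := Submodule.span K {t | ∃ x y : V, t = wedge K V x y}

/-- `S²(V)` realized as the subspace of symmetric tensors of `V ⊗ V`. -/
def sym2 : Submodule K (V ⊗[K] V) := Submodule.span K {t | ∃ x y : V, t = vee K V x y}

variable {V}

lemma wedge_mem (x y : V) : wedge K V x y ∈ lambda2 K V := Submodule.subset_span ⟨x, y, rfl⟩

lemma vee_mem (x y : V) : vee K V x y ∈ sym2 K V := Submodule.subset_span ⟨x, y, rfl⟩

end Wedge

section LieRelaxed

variable (L : Type*) [LieRing L] [Module K L]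

/-- `∂(u ∧ v ∧ w) = ⁅u,v⁆ ∧ w + ⁅v,w⁆ ∧ u + ⁅w,u⁆ ∧ v`. -/
noncomputable def dd (u v w : L) : L ⊗[K] L :=
  wedge K L ⁅u, v⁆ w + wedge K L ⁅v, w⁆ u + wedge K L ⁅w, u⁆ v

/-- `B₂(L)`, the space of 2-boundaries, i.e. the image of `∂ : Λ³(L) → Λ²(L)`. -/
def B2 : Submodule K (L ⊗[K] L) := Submodule.span K {t | ∃ u v w : L, t = dd K L u v w}

variable {L}

lemma dd_mem_lambda2 (u v w : L) : dd K L u v w ∈ lambda2 K L :=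
  add_mem (add_mem (wedge_mem K _ _) (wedge_mem K _ _)) (wedge_mem K _ _)

lemma dd_mem_B2 (u v w : L) : dd K L u v w ∈ B2 K L := Submodule.subset_span ⟨u, v, w, rfl⟩

end LieRelaxed

section Lie

variable (L : Type*) [LieRing L] [LieAlgebra K L]

/-- The bracket `b : L ⊗ L → L`, `u ⊗ v ↦ ⁅u,v⁆`, as a linear map. -/
noncomputable def bracketHom : L ⊗[K] L →ₗ[K] L :=
  TensorProduct.lift (LinearMap.mk₂ K (fun u v => ⁅u, v⁆) add_lie smul_lie lie_add lie_smul)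

/-- `Z₂(L) = Λ²(L) ∩ ker b`, the space of 2-cycles. -/
noncomputable def Z2 : Submodule K (L ⊗[K] L) := lambda2 K L ⊓ LinearMap.ker (bracketHom K L)

/-- The derived algebra `L' = [L,L]`, as a subspace of `L`. -/
def derived : Submodule K L := Submodule.span K {m | ∃ u v : L, m = ⁅u, v⁆}

end Lie

section Alg

variable (A : Type*) [CommRing A] [Algebra K A]

/-- `I_A ⊆ S²(A)`: the kernel of the multiplication map `S²(A) → A`. -/
noncomputable def ia : Submodule K (A ⊗[K] A) := sym2 K A ⊓ LinearMap.ker (LinearMap.mul' K A)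

/-- `T(A) ⊆ Λ²(A)`: the span of the elements `ab ∧ c + bc ∧ a + ca ∧ b`. -/
def TA : Submodule K (A ⊗[K] A) :=
  Submodule.span K
    {t | ∃ a b c : A, t = wedge K A (a*b) c + wedge K A (b*c) a + wedge K A (c*a) b}

/-- `T₀(A) ⊆ Λ²(A)`: the span of the elements `ab ∧ c + bc ∧ a + ca ∧ b - abc ∧ 1`. -/
def T0A : Submodule K (A ⊗[K] A) :=
  Submodule.span K
    {t | ∃ a b c : A,
      t = wedge K A (a*b) c + wedge K A (b*c) a + wedge K A (c*a) b - wedge K A (a*b*c) 1}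

variable {A}

lemma TA_el_mem_lambda2 (a b c : A) :
    wedge K A (a*b) c + wedge K A (b*c) a + wedge K A (c*a) b ∈ lambda2 K A :=
  add_mem (add_mem (wedge_mem K _ _) (wedge_mem K _ _)) (wedge_mem K _ _)

lemma T0A_el_mem_lambda2 (a b c : A) :
    wedge K A (a*b) c + wedge K A (b*c) a + wedge K A (c*a) b - wedge K A (a*b*c) 1 ∈
      lambda2 K A :=
  sub_mem (TA_el_mem_lambda2 K a b c) (wedge_mem K _ _)

lemma ia_el_mem (a b : A) : vee K A a b - vee K A (a * b) 1 ∈ ia K A := by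
  refine Submodule.mem_inf.mpr ⟨sub_mem (vee_mem K a b) (vee_mem K _ _), ?_⟩
  simp only [LinearMap.mem_ker, map_sub, vee, map_smul, map_add, LinearMap.mul'_apply,
    mul_one, one_mul, mul_comm b a]
  simp

end Alg

section Current

variable (A : Type*) [CommRing A] [Algebra K A]
variable (k : Type*) [LieRing k] [LieAlgebra K k]

lemma g_smul_lie (c : K) (x y : A ⊗[K] k) : ⁅c • x, y⁆ = c • ⁅x, y⁆ := by
  rw [← algebraMap_smul A c x, ← algebraMap_smul A c ⁅x, y⁆, smul_lie]

lemma g_lie_smul (c : K) (x y : A ⊗[K] k) : ⁅x, c • y⁆ = c • ⁅x, y⁆ := by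
  rw [← algebraMap_smul A c y, ← algebraMap_smul A c ⁅x, y⁆, lie_smul]

/-- The bracket of the current algebra `g = A ⊗ k`, as a `K`-linear map `g ⊗ g → g`. -/
noncomputable def gBracket : (A ⊗[K] k) ⊗[K] (A ⊗[K] k) →ₗ[K] A ⊗[K] k :=
  TensorProduct.lift (LinearMap.mk₂ K (fun u v => ⁅u, v⁆) add_lie
    (fun c x y => g_smul_lie K A k c x y) lie_add (fun c x y => g_lie_smul K A k c x y))

/-- `Z₂(g) = Λ²(g) ∩ ker b` for the current algebra `g = A ⊗ k`. -/
noncomputable def Z2g : Submodule K ((A ⊗[K] k) ⊗[K] (A ⊗[K] k)) :=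
  lambda2 K (A ⊗[K] k) ⊓ LinearMap.ker (gBracket K A k)

/-- The first summand `Λ²(A) ⊗ S²(k)` of the decomposition of `Λ²(A ⊗ k)`. -/
abbrev M1 := (↥(lambda2 K A)) ⊗[K] (↥(sym2 K k))

/-- The second summand `A ⊗ Λ²(k)` of the decomposition of `Λ²(A ⊗ k)`. -/
abbrev M2 := A ⊗[K] (↥(lambda2 K k))

/-- The third summand `I_A ⊗ Λ²(k)` of the decomposition of `Λ²(A ⊗ k)`. -/
abbrev M3 := (↥(ia K A)) ⊗[K] (↥(lambda2 K k))

/-- The target of the isomorphism `P = (p₁,p₂,p₃)`. -/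
abbrev Wspace := M1 K A k × M2 K A k × M3 K A k

variable {A k}

/-- The property characterizing the linear isomorphism
`P = (p₁,p₂,p₃) : Λ²(A ⊗ k) ≅ (Λ²(A) ⊗ S²(k)) ⊕ (A ⊗ Λ²(k)) ⊕ (I_A ⊗ Λ²(k))`:
`p₁(ax ∧ by) = a ∧ b ⊗ x ∨ y`, `p₂(ax ∧ by) = ab ⊗ x ∧ y`,
`p₃(ax ∧ by) = (a ∨ b - ab ∨ 1) ⊗ x ∧ y`. -/
def IsDecomposition (P : ↥(lambda2 K (A ⊗[K] k)) ≃ₗ[K] Wspace K A k) : Prop :=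
  ∀ (a b : A) (x y : k),
    P ⟨wedge K (A ⊗[K] k) (a ⊗ₜ x) (b ⊗ₜ y), wedge_mem K _ _⟩ =
      ((⟨wedge K A a b, wedge_mem K a b⟩ ⊗ₜ[K] ⟨vee K k x y, vee_mem K x y⟩ : M1 K A k),
       ((a * b) ⊗ₜ[K] ⟨wedge K k x y, wedge_mem K x y⟩ : M2 K A k),
       ((⟨vee K A a b - vee K A (a * b) 1, ia_el_mem K a b⟩ ⊗ₜ[K]
          ⟨wedge K k x y, wedge_mem K x y⟩ : M3 K A k)))

end Current

end CurrentPaper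

namespace CurrentPaper

variable (K : Type*) [Field K] [CharZero K]
variable (A : Type*) [CommRing A] [Algebra K A]
variable (k : Type*) [LieRing k] [LieAlgebra K k]

/-- The commutator ideal `k' = [k,k]` of `k`. -/
noncomputable def commIdeal : LieIdeal K k := ⁅(⊤ : LieIdeal K k), (⊤ : LieIdeal K k)⁆

/-- The abelianization `k/k'`. -/
noncomputable abbrev kAb := k ⧸ commIdeal K k

/-- The quotient map `k → k/k'` as a linear map. -/
noncomputable def kAbMap : k →ₗ[K] kAb K k :=
  (LieSubmodule.Quotient.mk' (commIdeal K k)).toLinearMap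

/-- The quotient map `g → g/g' ≅ A ⊗ (k/k')` as a linear map. -/
noncomputable def gAbMap : (A ⊗[K] k) →ₗ[K] (A ⊗[K] kAb K k) :=
  TensorProduct.map LinearMap.id (kAbMap K k)

section Cocycles

variable (L : Type*) [LieRing L] [Module K L]

/-- The space `Z²(L) = Z²(L,K)` of `K`-valued 2-cocycles on `L`, realized as linear
forms on `Λ²(L)` vanishing on `B₂(L)`. -/
noncomputable def Zc2 : Submodule K (↥(lambda2 K L) →ₗ[K] K) where
  carrier := {f | ∀ t : ↥(lambda2 K L), (t : L ⊗[K] L) ∈ B2 K L → f t = 0}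
  add_mem' := by
    intro f g hf hg t ht
    simp [LinearMap.add_apply, hf t ht, hg t ht]
  zero_mem' := by intro t ht; rfl
  smul_mem' := by
    intro c f hf t ht
    simp [LinearMap.smul_apply, hf t ht]

/-- The space `B²(L) = B²(L,K)` of `K`-valued 2-coboundaries on `L`. -/
noncomputable def Bc2 : Submodule K (↥(lambda2 K L) →ₗ[K] K) where
  carrier := {f | ∃ ℓ : L →ₗ[K] K, ∀ u v : L,
    f ⟨wedge K L u v, wedge_mem K u v⟩ = -ℓ ⁅u, v⁆}
  add_mem' := by
    rintro f g ⟨lf, hf⟩ ⟨lg, hg⟩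
    exact ⟨lf + lg, fun u v => by
      simp only [LinearMap.add_apply, hf u v, hg u v]; ring⟩
  zero_mem' := ⟨0, by simp⟩
  smul_mem' := by
    rintro c f ⟨l, hl⟩
    exact ⟨c • l, fun u v => by
      simp only [LinearMap.smul_apply, hl u v, smul_neg]⟩

/-- The second cohomology `H²(L) = Z²(L)/B²(L)`, realized as the image of `Z²(L)` in
the quotient of all linear forms on `Λ²(L)` by `B²(L)`. -/
noncomputable abbrev H2coh := ↥(Submodule.map (Bc2 K L).mkQ (Zc2 K L))

end Cocycles

/-- The cocycle `Φ(h, f̃₂) = (pull-back of h along g → g/g') + f₂∘p₂`. -/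
noncomputable def PhiCocycle (P : ↥(lambda2 K (A ⊗[K] k)) ≃ₗ[K] Wspace K A k)
    (h : (A ⊗[K] kAb K k) →ₗ[K] (A ⊗[K] kAb K k) →ₗ[K] K)
    (ft2 : A →ₗ[K] ↥(Zc2 K k)) : ↥(lambda2 K (A ⊗[K] k)) →ₗ[K] K :=
  ((TensorProduct.lift h).comp
      ((TensorProduct.map (gAbMap K A k) (gAbMap K A k)).comp
        (lambda2 K (A ⊗[K] k)).subtype)) +
  ((TensorProduct.lift ((Zc2 K k).subtype.comp ft2)).comp
      ((LinearMap.fst K (M2 K A k) (M3 K A k)).comp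
        ((LinearMap.snd K (M1 K A k) (M2 K A k × M3 K A k)).comp P.toLinearMap)))

section Helpers

section Bilinear

variable (V : Type*) [AddCommGroup V] [Module K V]

/-- `(x, y) ↦ x ∧ y` as a bilinear map with values in `Λ²(V)`. -/
noncomputable def wedgeHom : V →ₗ[K] V →ₗ[K] ↥(lambda2 K V) :=
  LinearMap.mk₂ K (fun x y => ⟨wedge K V x y, wedge_mem K x y⟩)
    (fun x x' y => Subtype.ext <| by
      simp only [wedge, TensorProduct.add_tmul, TensorProduct.tmul_add, Submodule.coe_add]
      module)
    (fun c x y => Subtype.ext <| by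
      simp only [wedge, ← TensorProduct.smul_tmul', TensorProduct.tmul_smul, Submodule.coe_smul]
      module)
    (fun x y y' => Subtype.ext <| by
      simp only [wedge, TensorProduct.add_tmul, TensorProduct.tmul_add, Submodule.coe_add]
      module)
    (fun c x y => Subtype.ext <| by
      simp only [wedge, ← TensorProduct.smul_tmul', TensorProduct.tmul_smul, Submodule.coe_smul]
      module)

variable {V}

lemma mk_wedge (x y : V) (h : wedge K V x y ∈ lambda2 K V) :
    (⟨wedge K V x y, h⟩ : ↥(lambda2 K V)) = wedgeHom K V x y := rfl

lemma coe_wedgeHom (x y : V) : (wedgeHom K V x y : V ⊗[K] V) = wedge K V x y := rfl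

lemma wedgeHom_swap (x y : V) : wedgeHom K V x y = (-1 : K) • wedgeHom K V y x :=
  Subtype.ext <| by
    simp only [coe_wedgeHom, wedge, Submodule.coe_smul]
    module

lemma wedgeHom_self (x : V) : wedgeHom K V x x = 0 :=
  Subtype.ext <| by simp [coe_wedgeHom, wedge]

lemma vee_comm (x y : V) : vee K V x y = vee K V y x := by
  rw [vee, vee, add_comm]

end Bilinear

lemma vanishes_on_B2_iff {L : Type*} [LieRing L] [Module K L] (G : ↥(lambda2 K L) →ₗ[K] K) :
    (∀ t : ↥(lambda2 K L), (t : L ⊗[K] L) ∈ B2 K L → G t = 0) ↔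
      ∀ u v w : L, G (wedgeHom K L ⁅u, v⁆ w) + G (wedgeHom K L ⁅v, w⁆ u) +
        G (wedgeHom K L ⁅w, u⁆ v) = 0 := by
  constructor
  · intro h u v w
    rw [← map_add, ← map_add]
    exact h _ (dd_mem_B2 K u v w)
  · intro h t ht
    have hle : B2 K L ≤ (LinearMap.ker G).map (lambda2 K L).subtype := by
      refine Submodule.span_le.mpr ?_
      rintro _ ⟨u, v, w, rfl⟩
      refine ⟨wedgeHom K L ⁅u, v⁆ w + wedgeHom K L ⁅v, w⁆ u + wedgeHom K L ⁅w, u⁆ v, ?_, rfl⟩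
      simpa using h u v w
    obtain ⟨t', ht', he⟩ := hle ht
    rw [← Subtype.ext he]
    exact ht'

variable {A k}

lemma lie_tmul_tmul (a b : A) (x y : k) :
    ⁅(a ⊗ₜ[K] x : A ⊗[K] k), (b ⊗ₜ[K] y : A ⊗[K] k)⁆ = (a * b) ⊗ₜ[K] ⁅x, y⁆ :=
  LieAlgebra.ExtendScalars.bracket_tmul K A k k a b x y

lemma vanishes_on_B2_current_iff (G : ↥(lambda2 K (A ⊗[K] k)) →ₗ[K] K) :
    (∀ t : ↥(lambda2 K (A ⊗[K] k)),
      (t : (A ⊗[K] k) ⊗[K] (A ⊗[K] k)) ∈ B2 K (A ⊗[K] k) → G t = 0) ↔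
      ∀ (a b c : A) (x y z : k),
        G (wedgeHom K (A ⊗[K] k) ((a * b) ⊗ₜ ⁅x, y⁆) (c ⊗ₜ z)) +
        G (wedgeHom K (A ⊗[K] k) ((b * c) ⊗ₜ ⁅y, z⁆) (a ⊗ₜ x)) +
        G (wedgeHom K (A ⊗[K] k) ((c * a) ⊗ₜ ⁅z, x⁆) (b ⊗ₜ y)) = 0 := by
  rw [vanishes_on_B2_iff]
  constructor
  · intro h a b c x y z
    simpa only [lie_tmul_tmul] using h (a ⊗ₜ x) (b ⊗ₜ y) (c ⊗ₜ z)
  · intro h u v w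
    induction u using TensorProduct.induction_on with
    | zero => simp
    | add u u' hu hu' =>
      simp only [add_lie, lie_add, map_add, LinearMap.add_apply] at hu hu' ⊢
      linear_combination hu + hu'
    | tmul a x =>
      induction v using TensorProduct.induction_on with
      | zero => simp
      | add v v' hv hv' =>
        simp only [add_lie, lie_add, map_add, LinearMap.add_apply] at hv hv' ⊢
        linear_combination hv + hv'
      | tmul b y =>
        induction w using TensorProduct.induction_on with
        | zero => simp
        | add w w' hw hw' =>
          simp only [add_lie, lie_add, map_add, LinearMap.add_apply] at hw hw' ⊢
          linear_combination hw + hw'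
        | tmul c z => simpa only [lie_tmul_tmul] using h a b c x y z

lemma eq_coboundary_of_tmul (G : ↥(lambda2 K (A ⊗[K] k)) →ₗ[K] K) (ℓ : (A ⊗[K] k) →ₗ[K] K)
    (h : ∀ (a b : A) (x y : k),
      G (wedgeHom K (A ⊗[K] k) (a ⊗ₜ x) (b ⊗ₜ y)) = -ℓ ((a * b) ⊗ₜ ⁅x, y⁆))
    (u v : A ⊗[K] k) : G (wedgeHom K (A ⊗[K] k) u v) = -ℓ ⁅u, v⁆ := by
  induction u using TensorProduct.induction_on with
  | zero => simp
  | add u u' hu hu' =>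
    simp only [add_lie, map_add, LinearMap.add_apply, hu, hu']
    ring
  | tmul a x =>
    induction v using TensorProduct.induction_on with
    | zero => simp
    | add v v' hv hv' =>
      simp only [lie_add, map_add, hv, hv']
      ring
    | tmul b y => rw [lie_tmul_tmul, h]

lemma linearMap_ext_wedgeHom {G G' : ↥(lambda2 K (A ⊗[K] k)) →ₗ[K] K}
    (h : ∀ (a b : A) (x y : k), G (wedgeHom K (A ⊗[K] k) (a ⊗ₜ x) (b ⊗ₜ y)) =
      G' (wedgeHom K (A ⊗[K] k) (a ⊗ₜ x) (b ⊗ₜ y))) (u v : A ⊗[K] k) :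
    G (wedgeHom K (A ⊗[K] k) u v) = G' (wedgeHom K (A ⊗[K] k) u v) := by
  have := eq_coboundary_of_tmul K (G - G') 0 (fun a b x y => by simp [h]) u v
  simpa [sub_eq_zero] using this

lemma mem_commIdeal_iff (x : k) : x ∈ commIdeal K k ↔ x ∈ derived K k := by
  rw [← LieSubmodule.mem_toSubmodule, commIdeal, LieSubmodule.lieIdeal_oper_eq_linear_span',
    derived]
  have : {m : k | ∃ x ∈ (⊤ : LieIdeal K k), ∃ n ∈ (⊤ : LieIdeal K k), ⁅x, n⁆ = m} =
      {m | ∃ u v : k, m = ⁅u, v⁆} := by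
    ext m
    simp [eq_comm]
  rw [this]

lemma kAbMap_eq_zero_iff (x : k) : kAbMap K k x = 0 ↔ x ∈ derived K k := by
  rw [← mem_commIdeal_iff]
  exact LieSubmodule.Quotient.mk_eq_zero' (N := commIdeal K k)

lemma lie_mem_derived (x y : k) : ⁅x, y⁆ ∈ derived K k := Submodule.subset_span ⟨x, y, rfl⟩

lemma kAbMap_lie (x y : k) : kAbMap K k ⁅x, y⁆ = 0 :=
  (kAbMap_eq_zero_iff K _).mpr (lie_mem_derived K x y)

lemma kAbMap_surjective : Function.Surjective (kAbMap K k) :=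
  LieSubmodule.Quotient.surjective_mk' (commIdeal K k)

lemma PhiCocycle_wedgeHom {P : ↥(lambda2 K (A ⊗[K] k)) ≃ₗ[K] Wspace K A k}
    (hP : IsDecomposition K P) {h : (A ⊗[K] kAb K k) →ₗ[K] (A ⊗[K] kAb K k) →ₗ[K] K}
    (hh : ∀ u, h u u = 0) (ft2 : A →ₗ[K] ↥(Zc2 K k)) (a b : A) (x y : k) :
    PhiCocycle K A k P h ft2 (wedgeHom K (A ⊗[K] k) (a ⊗ₜ x) (b ⊗ₜ y)) =
      h (a ⊗ₜ kAbMap K k x) (b ⊗ₜ kAbMap K k y) +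
        (ft2 (a * b) : ↥(lambda2 K k) →ₗ[K] K) (wedgeHom K k x y) := by
  have hswap : h (b ⊗ₜ kAbMap K k y) (a ⊗ₜ kAbMap K k x) =
      -h (a ⊗ₜ kAbMap K k x) (b ⊗ₜ kAbMap K k y) := by
    have := LinearMap.IsAlt.neg (B := h) hh (a ⊗ₜ kAbMap K k x) (b ⊗ₜ kAbMap K k y)
    exact this.symm
  have h2 : (2 : K) ≠ 0 := two_ne_zero
  have hPw := hP a b x y
  rw [mk_wedge] at hPw
  simp only [PhiCocycle, LinearMap.add_apply, LinearMap.comp_apply, LinearEquiv.coe_coe, hPw,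
    Submodule.subtype_apply, coe_wedgeHom, wedge, map_smul, map_sub, TensorProduct.map_tmul,
    gAbMap, LinearMap.id_apply, TensorProduct.lift.tmul, hswap, LinearMap.fst_apply,
    LinearMap.snd_apply]
  congr 1
  rw [smul_eq_mul]
  field_simp
  ring

lemma exists_form_on_abelianization (G : ↥(lambda2 K (A ⊗[K] k)) →ₗ[K] K)
    (hG : ∀ (a b : A) (x y : k), y ∈ derived K k →
      G (wedgeHom K (A ⊗[K] k) (a ⊗ₜ x) (b ⊗ₜ y)) = 0) :
    ∃ h : (A ⊗[K] kAb K k) →ₗ[K] (A ⊗[K] kAb K k) →ₗ[K] K,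
      (∀ u, h u u = 0) ∧ ∀ (a b : A) (x y : k),
        h (a ⊗ₜ kAbMap K k x) (b ⊗ₜ kAbMap K k y) =
          G (wedgeHom K (A ⊗[K] k) (a ⊗ₜ x) (b ⊗ₜ y)) := by
  obtain ⟨s, hs⟩ := (kAbMap K k).exists_rightInverse_of_surjective
    (LinearMap.range_eq_top.mpr (kAbMap_surjective K))
  have hs' : ∀ x : k, x - s (kAbMap K k x) ∈ derived K k := fun x => by
    rw [← kAbMap_eq_zero_iff, map_sub, sub_eq_zero]
    exact (LinearMap.congr_fun hs (kAbMap K k x)).symm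
  have hr : ∀ (a b : A) (x y : k), G (wedgeHom K (A ⊗[K] k) (a ⊗ₜ x) (b ⊗ₜ y)) =
      G (wedgeHom K (A ⊗[K] k) (a ⊗ₜ x) (b ⊗ₜ s (kAbMap K k y))) := fun a b x y => by
    have hy : y = (y - s (kAbMap K k y)) + s (kAbMap K k y) := (sub_add_cancel _ _).symm
    conv_lhs => rw [hy]
    rw [TensorProduct.tmul_add, map_add, map_add, hG a b x _ (hs' y), zero_add]
  refine ⟨(((wedgeHom K (A ⊗[K] k)).compl₁₂ (s.lTensor A) (s.lTensor A)).compr₂ G),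
    fun u => ?_, fun a b x y => ?_⟩
  · simp [wedgeHom_self]
  · simp only [LinearMap.compr₂_apply, LinearMap.compl₁₂_apply, LinearMap.lTensor_tmul]
    rw [hr a b x y, wedgeHom_swap, map_smul, ← hr, ← map_smul, ← wedgeHom_swap]

/-- The element `a ∨ b - ab ∨ 1` of `I_A`. -/
noncomputable def iaElem (a b : A) : ↥(ia K A) :=
  ⟨vee K A a b - vee K A (a * b) 1, ia_el_mem K a b⟩

lemma iaElem_one_right (a : A) : iaElem K a 1 = 0 :=
  Subtype.ext <| by simp [iaElem]

lemma iaElem_comm (a b : A) : iaElem K a b = iaElem K b a :=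
  Subtype.ext <| by simp [iaElem, vee_comm K a b, mul_comm a b]

/-- The element `x ∨ y` of `S²(V)`. -/
noncomputable def veeElem {V : Type*} [AddCommGroup V] [Module K V] (x y : V) : ↥(sym2 K V) :=
  ⟨vee K V x y, vee_mem K x y⟩

lemma veeElem_comm {V : Type*} [AddCommGroup V] [Module K V] (x y : V) :
    veeElem K x y = veeElem K y x :=
  Subtype.ext (vee_comm K x y)

lemma IsDecomposition.apply {P : ↥(lambda2 K (A ⊗[K] k)) ≃ₗ[K] Wspace K A k}
    (hP : IsDecomposition K P) (a b : A) (x y : k) :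
    P (wedgeHom K (A ⊗[K] k) (a ⊗ₜ x) (b ⊗ₜ y)) =
      (wedgeHom K A a b ⊗ₜ veeElem K x y, (a * b) ⊗ₜ wedgeHom K k x y,
        iaElem K a b ⊗ₜ wedgeHom K k x y) :=
  hP a b x y

/-- The linear form `f₁ ∘ p₁ + f₂ ∘ p₂ + f₃ ∘ p₃` on `Λ²(g)`. -/
noncomputable def sumForm (P : ↥(lambda2 K (A ⊗[K] k)) ≃ₗ[K] Wspace K A k)
    (f1 : M1 K A k →ₗ[K] K) (f2 : M2 K A k →ₗ[K] K) (f3 : M3 K A k →ₗ[K] K) :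
    ↥(lambda2 K (A ⊗[K] k)) →ₗ[K] K :=
  (f1.coprod (f2.coprod f3)) ∘ₗ P.toLinearMap

lemma sumForm_apply (P : ↥(lambda2 K (A ⊗[K] k)) ≃ₗ[K] Wspace K A k)
    (f1 : M1 K A k →ₗ[K] K) (f2 : M2 K A k →ₗ[K] K) (f3 : M3 K A k →ₗ[K] K)
    (t : ↥(lambda2 K (A ⊗[K] k))) :
    sumForm K P f1 f2 f3 t = f1 (P t).1 + f2 (P t).2.1 + f3 (P t).2.2 := by
  simp [sumForm, add_assoc]

lemma sumForm_wedgeHom {P : ↥(lambda2 K (A ⊗[K] k)) ≃ₗ[K] Wspace K A k}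
    (hP : IsDecomposition K P)
    (f1 : M1 K A k →ₗ[K] K) (f2 : M2 K A k →ₗ[K] K) (f3 : M3 K A k →ₗ[K] K)
    (a b : A) (x y : k) :
    sumForm K P f1 f2 f3 (wedgeHom K (A ⊗[K] k) (a ⊗ₜ x) (b ⊗ₜ y)) =
      f1 (wedgeHom K A a b ⊗ₜ veeElem K x y) + f2 ((a * b) ⊗ₜ wedgeHom K k x y) +
        f3 (iaElem K a b ⊗ₜ wedgeHom K k x y) := by
  rw [sumForm_apply, hP.apply]

lemma second_component_mem_Zc2
    {P : ↥(lambda2 K (A ⊗[K] k)) ≃ₗ[K] Wspace K A k} (hP : IsDecomposition K P)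
    {f1 : M1 K A k →ₗ[K] K} {f2 : M2 K A k →ₗ[K] K} {f3 : M3 K A k →ₗ[K] K}
    (hcoc : ∀ t : ↥(lambda2 K (A ⊗[K] k)),
      (t : (A ⊗[K] k) ⊗[K] (A ⊗[K] k)) ∈ B2 K (A ⊗[K] k) → sumForm K P f1 f2 f3 t = 0)
    (hf1 : ∀ (a b : A) (x y : k), y ∈ derived K k →
      f1 (wedgeHom K A a b ⊗ₜ veeElem K x y) = 0)
    (a : A) :
    f2 ∘ₗ TensorProduct.mk K A (↥(lambda2 K k)) a ∈ Zc2 K k := by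
  refine (vanishes_on_B2_iff K _).mpr fun x y z => ?_
  have h := (vanishes_on_B2_current_iff K _).mp hcoc a 1 1 x y z
  have hl : ∀ (b c : A) (u v w : k),
      f1 (wedgeHom K A b c ⊗ₜ veeElem K ⁅u, v⁆ w) = 0 := fun b c u v w => by
    rw [veeElem_comm]
    exact hf1 b c w _ (lie_mem_derived K u v)
  simpa [sumForm_wedgeHom K hP, hl, iaElem_one_right, iaElem_comm K 1 a] using h

lemma third_component_vanishes
    {P : ↥(lambda2 K (A ⊗[K] k)) ≃ₗ[K] Wspace K A k} (hP : IsDecomposition K P)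
    {f1 : M1 K A k →ₗ[K] K} {f2 : M2 K A k →ₗ[K] K} {f3 : M3 K A k →ₗ[K] K}
    (hcoc : ∀ t : ↥(lambda2 K (A ⊗[K] k)),
      (t : (A ⊗[K] k) ⊗[K] (A ⊗[K] k)) ∈ B2 K (A ⊗[K] k) → sumForm K P f1 f2 f3 t = 0)
    (hf1 : ∀ (a b : A) (x y : k), y ∈ derived K k →
      f1 (wedgeHom K A a b ⊗ₜ veeElem K x y) = 0)
    (a b : A) (x y : k) (hy : y ∈ derived K k) :
    f3 (iaElem K a b ⊗ₜ wedgeHom K k x y) = 0 := by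
  have hl : ∀ (b c : A) (u v w : k),
      f1 (wedgeHom K A b c ⊗ₜ veeElem K ⁅u, v⁆ w) = 0 := fun b c u v w => by
    rw [veeElem_comm]
    exact hf1 b c w _ (lie_mem_derived K u v)
  let T : k → k → k → K := fun x y z => f3 (iaElem K a b ⊗ₜ wedgeHom K k x ⁅y, z⁆)
  have hanti : ∀ x y z, T x y z = -T x z y := fun x y z => by
    have hyz : ⁅y, z⁆ = (-1 : K) • ⁅z, y⁆ := by rw [neg_one_smul, lie_skew]
    simp only [T]
    rw [hyz, map_smul, TensorProduct.tmul_smul, map_smul, neg_one_smul]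
  have hsymm : ∀ x y z, T x y z = T y x z := fun x y z => by
    have h := (vanishes_on_B2_current_iff K _).mp hcoc a b 1 x y z
    have h2 := second_component_mem_Zc2 K hP hcoc hf1 (a * b)
    have h2 := (vanishes_on_B2_iff K _).mp h2 x y z
    simp only [LinearMap.comp_apply, TensorProduct.mk_apply] at h2
    simp only [sumForm_wedgeHom K hP, hl, iaElem_one_right, iaElem_comm K b a, mul_one, one_mul,
      TensorProduct.zero_tmul, map_zero, mul_comm b a, zero_add, add_zero] at h
    rw [hanti y x z]
    simp only [T]
    rw [wedgeHom_swap K x, wedgeHom_swap K y, TensorProduct.tmul_smul, TensorProduct.tmul_smul,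
      map_smul, map_smul, neg_one_smul, neg_one_smul]
    linear_combination h2 - h
  have hzero : ∀ x y z, T x y z = 0 := fun x y z => by
    have h : T x y z = -T x y z := calc
      T x y z = T y x z := hsymm x y z
      _ = -T y z x := hanti y x z
      _ = -T z y x := by rw [hsymm y z x]
      _ = T z x y := by rw [hanti z y x, neg_neg]
      _ = T x z y := hsymm z x y
      _ = -T x y z := hanti x z y
    exact self_eq_neg.mp h
  induction hy using Submodule.span_induction with
  | mem y hy =>
    obtain ⟨u, v, rfl⟩ := hy
    exact hzero x u v
  | zero => simp
  | add y y' _ _ hy hy' => simp [TensorProduct.tmul_add, hy, hy']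
  | smul c y _ hy => simp [hy]

/-- The coboundary operator `ℓ ↦ ((x, y) ↦ -ℓ ⁅x, y⁆)` on linear forms. -/
noncomputable def coboundary (k : Type*) [LieRing k] [LieAlgebra K k] :
    (k →ₗ[K] K) →ₗ[K] (↥(lambda2 K k) →ₗ[K] K) :=
  -LinearMap.lcomp K K (bracketHom K k ∘ₗ (lambda2 K k).subtype)

lemma coboundary_wedgeHom (ℓ : k →ₗ[K] K) (x y : k) :
    coboundary K k ℓ (wedgeHom K k x y) = -ℓ ⁅x, y⁆ := by
  have h2 : (2 : K) ≠ 0 := two_ne_zero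
  have hs : ℓ ⁅y, x⁆ = -ℓ ⁅x, y⁆ := by rw [← lie_skew, map_neg]
  simp only [coboundary, LinearMap.neg_apply, LinearMap.lcomp_apply, LinearMap.comp_apply,
    Submodule.subtype_apply, coe_wedgeHom, wedge, map_smul, map_sub, bracketHom,
    TensorProduct.lift.tmul, LinearMap.mk₂_apply, hs, smul_eq_mul]
  field_simp
  ring

lemma Bc2_le_range_coboundary : Bc2 K k ≤ LinearMap.range (coboundary K k) := by
  rintro f ⟨ℓ, hℓ⟩
  refine ⟨ℓ, LinearMap.ext fun t => ?_⟩
  obtain ⟨t, ht⟩ := t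
  induction ht using Submodule.span_induction with
  | mem t ht =>
    obtain ⟨x, y, rfl⟩ := ht
    exact (coboundary_wedgeHom K ℓ x y).trans (hℓ x y).symm
  | zero => exact (map_zero (coboundary K k ℓ)).trans (map_zero f).symm
  | add t t' ht ht' h h' =>
    have := congrArg₂ (· + ·) h h'
    simp only [← map_add] at this
    exact this
  | smul c t ht h =>
    have := congrArg (c • ·) h
    simp only [← map_smul] at this
    exact this

lemma exists_coboundary_lift (g : A →ₗ[K] (↥(lambda2 K k) →ₗ[K] K))
    (hg : ∀ a, g a ∈ Bc2 K k) :
    ∃ ℓ : (A ⊗[K] k) →ₗ[K] K, ∀ (a : A) (x y : k),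
      g a (wedgeHom K k x y) = -ℓ (a ⊗ₜ ⁅x, y⁆) := by
  obtain ⟨m, hm⟩ := Module.projective_lifting_property (coboundary K k).rangeRestrict
    (g.codRestrict _ fun a => Bc2_le_range_coboundary K (hg a))
    (coboundary K k).surjective_rangeRestrict
  refine ⟨TensorProduct.lift m, fun a x y => ?_⟩
  have := congrArg Subtype.val (LinearMap.congr_fun hm a)
  rw [TensorProduct.lift.tmul, ← coboundary_wedgeHom]
  exact (LinearMap.congr_fun this (wedgeHom K k x y)).symm

end Helpers

/-- The map
`Φ : H²(g/g')_{1,3} ⊕ Lin(A, H²(k)) → H²(g)` is well defined and injective, and its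
image consists precisely of the cohomology classes of 2-cocycles of the form
`f₁⁰∘p₁ + f₂∘p₂ + f₃∘p₃` with `f₁⁰∘p₁` vanishing on `g × g'`. -/
theorem statement16
    (P : ↥(lambda2 K (A ⊗[K] k)) ≃ₗ[K] Wspace K A k) (hP : IsDecomposition K P) :
    -- Φ is well defined: its values are 2-cocycles on g
    (∀ (h : (A ⊗[K] kAb K k) →ₗ[K] (A ⊗[K] kAb K k) →ₗ[K] K),
      (∀ u, h u u = 0) →
      (∀ (a : A) (x y : k),
        h (a ⊗ₜ[K] kAbMap K k x) ((1 : A) ⊗ₜ[K] kAbMap K k y) =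
          h (a ⊗ₜ[K] kAbMap K k y) ((1 : A) ⊗ₜ[K] kAbMap K k x)) →
      ∀ ft2 : A →ₗ[K] ↥(Zc2 K k),
        ∀ t : ↥(lambda2 K (A ⊗[K] k)),
          (t : (A ⊗[K] k) ⊗[K] (A ⊗[K] k)) ∈ B2 K (A ⊗[K] k) →
          PhiCocycle K A k P h ft2 t = 0) ∧
    -- Φ is well defined: the class does not depend on the chosen lift of ψ
    (∀ (h : (A ⊗[K] kAb K k) →ₗ[K] (A ⊗[K] kAb K k) →ₗ[K] K),
      (∀ u, h u u = 0) →
      (∀ (a : A) (x y : k),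
        h (a ⊗ₜ[K] kAbMap K k x) ((1 : A) ⊗ₜ[K] kAbMap K k y) =
          h (a ⊗ₜ[K] kAbMap K k y) ((1 : A) ⊗ₜ[K] kAbMap K k x)) →
      ∀ ft2 ft2' : A →ₗ[K] ↥(Zc2 K k),
        (∀ a : A, (Bc2 K k).mkQ ↑(ft2 a) = (Bc2 K k).mkQ ↑(ft2' a)) →
        ∃ ℓ : (A ⊗[K] k) →ₗ[K] K, ∀ u v : A ⊗[K] k,
          PhiCocycle K A k P h ft2 ⟨wedge K (A ⊗[K] k) u v, wedge_mem K u v⟩ -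
            PhiCocycle K A k P h ft2' ⟨wedge K (A ⊗[K] k) u v, wedge_mem K u v⟩ =
              -ℓ ⁅u, v⁆) ∧
    -- Φ is injective
    (∀ (h : (A ⊗[K] kAb K k) →ₗ[K] (A ⊗[K] kAb K k) →ₗ[K] K),
      (∀ u, h u u = 0) →
      (∀ (a : A) (x y : k),
        h (a ⊗ₜ[K] kAbMap K k x) ((1 : A) ⊗ₜ[K] kAbMap K k y) =
          h (a ⊗ₜ[K] kAbMap K k y) ((1 : A) ⊗ₜ[K] kAbMap K k x)) →
      ∀ ft2 : A →ₗ[K] ↥(Zc2 K k),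
        (∃ ℓ : (A ⊗[K] k) →ₗ[K] K, ∀ u v : A ⊗[K] k,
          PhiCocycle K A k P h ft2 ⟨wedge K (A ⊗[K] k) u v, wedge_mem K u v⟩ =
            -ℓ ⁅u, v⁆) →
        h = 0 ∧ ∀ a : A, (Bc2 K k).mkQ ↑(ft2 a) = 0) ∧
    -- the image of Φ consists precisely of the classes of cocycles
    -- f₁⁰∘p₁ + f₂∘p₂ + f₃∘p₃ with f₁⁰∘p₁ vanishing on g × g'
    (∀ F : ↥(lambda2 K (A ⊗[K] k)) →ₗ[K] K,
      (∀ t : ↥(lambda2 K (A ⊗[K] k)),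
        (t : (A ⊗[K] k) ⊗[K] (A ⊗[K] k)) ∈ B2 K (A ⊗[K] k) → F t = 0) →
      ((∃ h : (A ⊗[K] kAb K k) →ₗ[K] (A ⊗[K] kAb K k) →ₗ[K] K,
          (∀ u, h u u = 0) ∧
          (∀ (a : A) (x y : k),
            h (a ⊗ₜ[K] kAbMap K k x) ((1 : A) ⊗ₜ[K] kAbMap K k y) =
              h (a ⊗ₜ[K] kAbMap K k y) ((1 : A) ⊗ₜ[K] kAbMap K k x)) ∧
          ∃ (ft2 : A →ₗ[K] ↥(Zc2 K k)) (ℓ : (A ⊗[K] k) →ₗ[K] K),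
            ∀ u v : A ⊗[K] k,
              F ⟨wedge K (A ⊗[K] k) u v, wedge_mem K u v⟩ -
                PhiCocycle K A k P h ft2 ⟨wedge K (A ⊗[K] k) u v, wedge_mem K u v⟩ =
                  -ℓ ⁅u, v⁆) ↔
        (∃ (f1 : M1 K A k →ₗ[K] K) (f2 : M2 K A k →ₗ[K] K) (f3 : M3 K A k →ₗ[K] K)
            (ℓ : (A ⊗[K] k) →ₗ[K] K),
          (∀ t : ↥(lambda2 K (A ⊗[K] k)),
            (t : (A ⊗[K] k) ⊗[K] (A ⊗[K] k)) ∈ B2 K (A ⊗[K] k) →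
              f1 (P t).1 + f2 (P t).2.1 + f3 (P t).2.2 = 0) ∧
          (∀ (a b : A) (x y : k), y ∈ derived K k →
            f1 (⟨wedge K A a b, wedge_mem K a b⟩ ⊗ₜ[K]
                ⟨vee K k x y, vee_mem K x y⟩) = 0) ∧
          ∀ u v : A ⊗[K] k,
            F ⟨wedge K (A ⊗[K] k) u v, wedge_mem K u v⟩ -
              (f1 (P ⟨wedge K (A ⊗[K] k) u v, wedge_mem K u v⟩).1 +
               f2 (P ⟨wedge K (A ⊗[K] k) u v, wedge_mem K u v⟩).2.1 +
               f3 (P ⟨wedge K (A ⊗[K] k) u v, wedge_mem K u v⟩).2.2) = -ℓ ⁅u, v⁆))) := by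
  have hcocycle : ∀ h : (A ⊗[K] kAb K k) →ₗ[K] (A ⊗[K] kAb K k) →ₗ[K] K,
      (∀ u, h u u = 0) →
      (∀ (a : A) (x y : k),
        h (a ⊗ₜ[K] kAbMap K k x) ((1 : A) ⊗ₜ[K] kAbMap K k y) =
          h (a ⊗ₜ[K] kAbMap K k y) ((1 : A) ⊗ₜ[K] kAbMap K k x)) →
      ∀ ft2 : A →ₗ[K] ↥(Zc2 K k),
        ∀ t : ↥(lambda2 K (A ⊗[K] k)),
          (t : (A ⊗[K] k) ⊗[K] (A ⊗[K] k)) ∈ B2 K (A ⊗[K] k) →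
          PhiCocycle K A k P h ft2 t = 0 := by
    intro h hh _ ft2
    rw [vanishes_on_B2_current_iff]
    intro a b c x y z
    have hz := (vanishes_on_B2_iff K _).mp (ft2 (a * b * c)).2 x y z
    have hbc : b * c * a = a * b * c := by ring
    have hca : c * a * b = a * b * c := by ring
    simp only [PhiCocycle_wedgeHom K hP hh, kAbMap_lie, TensorProduct.tmul_zero, map_zero,
      LinearMap.zero_apply, zero_add, hbc, hca]
    exact hz
  refine ⟨hcocycle, ?_, ?_, ?_⟩
  · intro h hh _ ft2 ft2' heq
    obtain ⟨ℓ, hℓ⟩ := exists_coboundary_lift K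
      ((Zc2 K k).subtype ∘ₗ ft2 - (Zc2 K k).subtype ∘ₗ ft2')
      (fun a => (Submodule.Quotient.eq _).mp (heq a))
    refine ⟨ℓ, fun u v => ?_⟩
    refine eq_coboundary_of_tmul K (PhiCocycle K A k P h ft2 - PhiCocycle K A k P h ft2') ℓ
      (fun a b x y => ?_) u v
    rw [← hℓ]
    simp [PhiCocycle_wedgeHom K hP hh]
  · rintro h hh hsymm ft2 ⟨ℓ, hℓ⟩
    have key : ∀ (a b : A) (x y : k), h (a ⊗ₜ kAbMap K k x) (b ⊗ₜ kAbMap K k y) +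
        (ft2 (a * b) : ↥(lambda2 K k) →ₗ[K] K) (wedgeHom K k x y) =
          -ℓ ((a * b) ⊗ₜ ⁅x, y⁆) := fun a b x y => by
      rw [← PhiCocycle_wedgeHom K hP hh, ← lie_tmul_tmul]
      exact hℓ _ _
    have hft2 : ∀ (a : A) (x y : k),
        (ft2 a : ↥(lambda2 K k) →ₗ[K] K) (wedgeHom K k x y) = -ℓ (a ⊗ₜ ⁅x, y⁆) :=
      fun a x y => by
        have h1 := key a 1 x y
        have h2 := key a 1 y x
        rw [mul_one] at h1 h2
        have hyx : ⁅y, x⁆ = (-1 : K) • ⁅x, y⁆ := by rw [neg_one_smul, lie_skew]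
        rw [wedgeHom_swap K y x, map_smul, hyx, TensorProduct.tmul_smul, map_smul,
          neg_one_smul, neg_one_smul, ← hsymm] at h2
        linear_combination (h1 - h2) / 2
    refine ⟨?_, fun a => ?_⟩
    · refine TensorProduct.ext' fun a x => TensorProduct.ext' fun b y => ?_
      obtain ⟨x, rfl⟩ := kAbMap_surjective K x
      obtain ⟨y, rfl⟩ := kAbMap_surjective K y
      have := key a b x y
      rw [hft2] at this
      simpa using this
    · refine (Submodule.Quotient.mk_eq_zero _).mpr ?_
      exact ⟨ℓ ∘ₗ TensorProduct.mk K A k a, hft2 a⟩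
  · intro F hF
    constructor
    · rintro ⟨h, hh, hsymm, ft2, ℓ, hℓ⟩
      set G := PhiCocycle K A k P h ft2 with hG
      have hcoc : ∀ t : ↥(lambda2 K (A ⊗[K] k)),
          (t : (A ⊗[K] k) ⊗[K] (A ⊗[K] k)) ∈ B2 K (A ⊗[K] k) → G t = 0 :=
        hcocycle h hh hsymm ft2
      have hsum : ∀ t, (G ∘ₗ P.symm.toLinearMap) (LinearMap.inl K _ _ (P t).1) +
          (G ∘ₗ P.symm.toLinearMap) (LinearMap.inr K _ _ (LinearMap.inl K _ _ (P t).2.1)) +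
          (G ∘ₗ P.symm.toLinearMap) (LinearMap.inr K _ _ (LinearMap.inr K _ _ (P t).2.2)) =
            G t := fun t => by
        rw [← map_add, ← map_add]
        simp
      refine ⟨G ∘ₗ P.symm.toLinearMap ∘ₗ LinearMap.inl K _ _,
        G ∘ₗ P.symm.toLinearMap ∘ₗ LinearMap.inr K _ _ ∘ₗ LinearMap.inl K _ _,
        G ∘ₗ P.symm.toLinearMap ∘ₗ LinearMap.inr K _ _ ∘ₗ LinearMap.inr K _ _, ℓ,
        fun t ht => (hsum t).trans (hcoc t ht), fun a b x y hy => ?_, fun u v => ?_⟩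
      · have hP1 : P ((2 : K)⁻¹ • (wedgeHom K (A ⊗[K] k) (a ⊗ₜ x) (b ⊗ₜ y) +
            wedgeHom K (A ⊗[K] k) (a ⊗ₜ y) (b ⊗ₜ x))) =
            LinearMap.inl K _ _ (wedgeHom K A a b ⊗ₜ veeElem K x y) := by
          rw [map_smul, map_add, hP.apply, hP.apply, veeElem_comm K y x, wedgeHom_swap K y x,
            TensorProduct.tmul_smul, TensorProduct.tmul_smul]
          refine Prod.ext ?_ (Prod.ext ?_ ?_)
          · simp only [Prod.smul_fst, Prod.fst_add, LinearMap.inl_apply]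
            module
          · simp only [Prod.smul_snd, Prod.snd_add, Prod.smul_fst, Prod.fst_add,
              LinearMap.inl_apply, Prod.fst_zero]
            module
          · simp only [Prod.smul_snd, Prod.snd_add, LinearMap.inl_apply, Prod.snd_zero]
            module
        change G (P.symm (LinearMap.inl K _ _ (wedgeHom K A a b ⊗ₜ veeElem K x y))) = 0
        have hy0 := (kAbMap_eq_zero_iff K y).mpr hy
        rw [← hP1, P.symm_apply_apply, map_smul, map_add, hG, PhiCocycle_wedgeHom K hP hh,
          PhiCocycle_wedgeHom K hP hh, wedgeHom_swap K y x, map_smul, hy0]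
        simp
      · refine (congrArg (F _ - ·) (hsum _)).trans (hℓ u v)
    · rintro ⟨f1, f2, f3, ℓ, hcoc, hf1, hℓ⟩
      have hcoc' : ∀ t : ↥(lambda2 K (A ⊗[K] k)),
          (t : (A ⊗[K] k) ⊗[K] (A ⊗[K] k)) ∈ B2 K (A ⊗[K] k) →
            sumForm K P f1 f2 f3 t = 0 := fun t ht => by
        rw [sumForm_apply]
        exact hcoc t ht
      obtain ⟨h, hh, hpull⟩ := exists_form_on_abelianization K (sumForm K P f1 0 f3)
        (fun a b x y hy => by
          rw [sumForm_wedgeHom K hP, third_component_vanishes K hP hcoc' hf1 a b x y hy]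
          rw [LinearMap.zero_apply, add_zero, add_zero]
          exact hf1 a b x y hy)
      refine ⟨h, hh, fun a x y => ?_, LinearMap.codRestrict (Zc2 K k)
        (TensorProduct.curry f2) (second_component_mem_Zc2 K hP hcoc' hf1), ℓ, fun u v => ?_⟩
      · rw [hpull, hpull]
        simp [sumForm_wedgeHom K hP, iaElem_one_right, veeElem_comm K x y]
      · rw [← hℓ u v, ← sumForm_apply]
        congr 1
        refine linearMap_ext_wedgeHom K (fun a b x y => ?_) u v
        rw [PhiCocycle_wedgeHom K hP hh, hpull]
        have hf2 : ((LinearMap.codRestrict (Zc2 K k) (TensorProduct.curry f2)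
            (second_component_mem_Zc2 K hP hcoc' hf1) (a * b) : ↥(Zc2 K k)) :
              ↥(lambda2 K k) →ₗ[K] K) (wedgeHom K k x y) =
              f2 ((a * b) ⊗ₜ wedgeHom K k x y) := rfl
        rw [hf2, sumForm_wedgeHom K hP, sumForm_wedgeHom K hP, LinearMap.zero_apply]
        ring

end CurrentPaper
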